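/- Let d ≥ 1 and let Ω ⊆ ℝ^d be an open set with nonempty complement. Let x_0 ∈ Ω and set δ = d(x_0) > 0. Let 0 < q < ∞ and σ ∈ ℝ. Then there is a constant C > 1, depending only on d, q and σ, such that for every Φ ∈ L²(ℝ^d) supported in B(x_0, δ/2): C⁻¹ δ^{1 − d/2 + (d−1)/q − σ} ‖Φ‖_{L²(B(x_0,δ/2))} ≤ ‖Φ‖_{L^{q,σ}_{av}(Ω)} ≤ C δ^{1 − d/2 + (d−1)/q − σ} ‖Φ‖_{L²(B(x_0,δ/2))}. -/

import Mathlib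

open MeasureTheory Metric Set ENNReal

noncomputable section

/-- `wdist Ω x = dist(x, ℝ^d ∖ Ω)`. -/
def wdist {d : ℕ} (Ω : Set (EuclideanSpace ℝ (Fin d))) (x : EuclideanSpace ℝ (Fin d)) : ℝ :=
  Metric.infDist x Ωᶜ

/-- The weighted averaged norm `‖H‖_{L^{q,σ}_{av}(Ω)}`. -/
def avNorm {d : ℕ} {F : Type*} [NormedAddCommGroup F] (q σ : ℝ)
    (Ω : Set (EuclideanSpace ℝ (Fin d))) (H : EuclideanSpace ℝ (Fin d) → F) : ℝ≥0∞ :=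
  (∫⁻ x in Ω,
      ((volume (Metric.ball x (wdist Ω x / 2)))⁻¹ *
          ∫⁻ y in Metric.ball x (wdist Ω x / 2), (‖H y‖₊ : ℝ≥0∞) ^ (2 : ℕ)) ^ (q / 2) *
        ENNReal.ofReal (wdist Ω x) ^ (q - 1 - q * σ)) ^ (1 / q)

lemma rpow_le_three_rpow_abs_mul {s t : ℝ} (α : ℝ) (ht : 0 < t) (hs : 0 < s)
    (h₁ : t ≤ 3 * s) (h₂ : s ≤ 3 * t) :
    ENNReal.ofReal t ^ α ≤ ENNReal.ofReal (3 ^ |α|) * ENNReal.ofReal s ^ α := by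
  rw [ENNReal.ofReal_rpow_of_pos ht, ENNReal.ofReal_rpow_of_pos hs,
    ← ENNReal.ofReal_mul (by positivity)]
  apply ENNReal.ofReal_le_ofReal
  rcases le_total 0 α with hα | hα
  · rw [abs_of_nonneg hα, ← Real.mul_rpow (by norm_num) hs.le]
    exact Real.rpow_le_rpow ht.le h₁ hα
  · rw [abs_of_nonpos hα, Real.rpow_neg (by norm_num), ← Real.inv_rpow (by norm_num),
      ← Real.mul_rpow (by norm_num) hs.le]
    exact Real.rpow_le_rpow_of_nonpos (by positivity) (by linarith) hα

lemma volume_ball_mul {d : ℕ} (hd : 1 ≤ d) (x : EuclideanSpace ℝ (Fin d)) {k δ : ℝ}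
    (hk : 0 ≤ k) (hδ : 0 < δ) :
    volume (ball x (k * δ)) =
      ENNReal.ofReal (k ^ d) * volume (ball (0 : EuclideanSpace ℝ (Fin d)) 1) *
        ENNReal.ofReal δ ^ (d : ℝ) := by
  have : Nonempty (Fin d) := ⟨⟨0, hd⟩⟩
  rw [Measure.addHaar_ball _ _ (by positivity), finrank_euclideanSpace_fin, mul_pow,
    ENNReal.ofReal_mul (by positivity), ENNReal.rpow_natCast, ENNReal.ofReal_pow hδ.le]
  ring

lemma rpow_scaling_identity {q : ℝ} (hq : 0 < q) (σ n : ℝ) {D : ℝ≥0∞} (h0 : D ≠ 0) (ht : D ≠ ⊤)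
    (a b c I : ℝ≥0∞) :
    ((a * D ^ (-n) * I) ^ (q / 2) * (b * D ^ (q - 1 - q * σ)) * (c * D ^ n)) ^ (1 / q) =
      (a ^ (q / 2) * b * c) ^ (1 / q) * D ^ (1 - n / 2 + (n - 1) / q - σ) * I ^ (1 / (2 : ℝ)) := by
  have hI : (I ^ (q / 2)) ^ (1 / q) = I ^ (1 / (2 : ℝ)) := by
    rw [← ENNReal.rpow_mul]; congr 1; field_simp
  have hD : ((D ^ (-n)) ^ (q / 2) * D ^ (q - 1 - q * σ) * D ^ n) ^ (1 / q) =
      D ^ (1 - n / 2 + (n - 1) / q - σ) := by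
    rw [← ENNReal.rpow_mul, ← ENNReal.rpow_add _ _ h0 ht, ← ENNReal.rpow_add _ _ h0 ht,
      ← ENNReal.rpow_mul]
    congr 1; field_simp; ring
  rw [← hI, ← hD, ← ENNReal.mul_rpow_of_nonneg _ _ (by positivity),
    ← ENNReal.mul_rpow_of_nonneg _ _ (by positivity)]
  congr 1
  rw [ENNReal.mul_rpow_of_nonneg _ _ (by positivity : 0 ≤ q / 2),
    ENNReal.mul_rpow_of_nonneg _ _ (by positivity : 0 ≤ q / 2)]
  ring

lemma wdist_le_wdist_add_dist {d : ℕ} (Ω : Set (EuclideanSpace ℝ (Fin d)))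
    (x y : EuclideanSpace ℝ (Fin d)) : wdist Ω x ≤ wdist Ω y + dist x y :=
  infDist_le_infDist_add_dist

lemma wdist_pos {d : ℕ} {Ω : Set (EuclideanSpace ℝ (Fin d))} (hΩ : IsOpen Ω)
    (hne : Ωᶜ.Nonempty) {x : EuclideanSpace ℝ (Fin d)} (hx : x ∈ Ω) : 0 < wdist Ω x :=
  (hΩ.isClosed_compl.notMem_iff_infDist_pos hne).1 (by simpa using hx)

lemma mem_of_wdist_pos {d : ℕ} {Ω : Set (EuclideanSpace ℝ (Fin d))}
    {x : EuclideanSpace ℝ (Fin d)} (hx : 0 < wdist Ω x) : x ∈ Ω := by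
  by_contra h
  exact hx.ne' (infDist_zero_of_mem h)

lemma avNorm_le_of_support_subset {d : ℕ} (hd : 1 ≤ d) {q : ℝ} (σ : ℝ) (hq : 0 < q) :
    ∃ C : ℝ≥0∞, C ≠ ⊤ ∧
      ∀ Ω : Set (EuclideanSpace ℝ (Fin d)), IsOpen Ω → Ωᶜ.Nonempty →
      ∀ x₀ ∈ Ω, ∀ Φ : EuclideanSpace ℝ (Fin d) → ℝ,
        Function.support Φ ⊆ ball x₀ (wdist Ω x₀ / 2) →
          avNorm q σ Ω Φ ≤
            C * ENNReal.ofReal (wdist Ω x₀) ^ (1 - (d : ℝ) / 2 + (d - 1 : ℝ) / q - σ) *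
              (∫⁻ y in ball x₀ (wdist Ω x₀ / 2), (‖Φ y‖₊ : ℝ≥0∞) ^ (2 : ℕ)) ^ (1 / (2 : ℝ)) := by
  set v := volume (ball (0 : EuclideanSpace ℝ (Fin d)) 1) with hv
  have hv0 : v ≠ 0 := (measure_ball_pos _ _ one_pos).ne'
  have hvt : v ≠ ⊤ := measure_ball_lt_top.ne
  set a : ℝ≥0∞ := (ENNReal.ofReal ((1 / 6) ^ d) * v)⁻¹ with ha
  have ha0 : ENNReal.ofReal ((1 / 6) ^ d) * v ≠ 0 :=
    mul_ne_zero (ENNReal.ofReal_pos.2 (by positivity)).ne' hv0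
  have hat : ENNReal.ofReal ((1 / 6) ^ d) * v ≠ ⊤ := ENNReal.mul_ne_top ENNReal.ofReal_ne_top hvt
  refine ⟨(a ^ (q / 2) * ENNReal.ofReal (3 ^ |q - 1 - q * σ|) *
    (ENNReal.ofReal (2 ^ d) * v)) ^ (1 / q), ?_, ?_⟩
  · refine ENNReal.rpow_ne_top_of_nonneg (by positivity) (ENNReal.mul_ne_top (ENNReal.mul_ne_top
      (ENNReal.rpow_ne_top_of_nonneg (by positivity) (ENNReal.inv_ne_top.2 ha0))
      ENNReal.ofReal_ne_top) (ENNReal.mul_ne_top ENNReal.ofReal_ne_top hvt))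
  intro Ω hΩ hne x₀ hx₀ Φ hΦ
  have hδ := wdist_pos hΩ hne hx₀
  set δ := wdist Ω x₀
  have hD0 : ENNReal.ofReal δ ≠ 0 := (ENNReal.ofReal_pos.2 hδ).ne'
  rw [← rpow_scaling_identity hq σ d hD0 ENNReal.ofReal_ne_top, avNorm,
    ← volume_ball_mul hd x₀ zero_le_two hδ]
  refine ENNReal.rpow_le_rpow ?_ (by positivity)
  rw [← lintegral_indicator_const measurableSet_ball, ← lintegral_indicator hΩ.measurableSet]
  refine lintegral_mono fun x => ?_
  refine indicator_apply_le' (fun hx => ?_) fun _ => zero_le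
  have hx' := wdist_pos hΩ hne hx
  by_cases hdisj : Disjoint (ball x (wdist Ω x / 2)) (ball x₀ (δ / 2))
  · have : ∫⁻ y in ball x (wdist Ω x / 2), (‖Φ y‖₊ : ℝ≥0∞) ^ (2 : ℕ) = 0 := by
      refine setLIntegral_eq_zero measurableSet_ball fun y hy => ?_
      have : Φ y = 0 := by
        by_contra h
        exact Set.disjoint_left.1 hdisj hy (hΦ h)
      simp [this]
    rw [this, mul_zero, ENNReal.zero_rpow_of_pos (by positivity), zero_mul]
    exact zero_le
  · obtain ⟨y, hy, hy₀⟩ := Set.not_disjoint_iff.1 hdisj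
    rw [mem_ball] at hy hy₀
    have h1 := wdist_le_wdist_add_dist Ω x x₀
    have h2 := wdist_le_wdist_add_dist Ω x₀ x
    have h3 := dist_triangle_left x x₀ y
    rw [dist_comm x₀ x] at h2
    change wdist Ω x ≤ δ + _ at h1
    change δ ≤ _ at h2
    rw [indicator_of_mem (by rw [mem_ball]; linarith)]
    refine mul_le_mul' (ENNReal.rpow_le_rpow (mul_le_mul' ?_ ?_) (by positivity))
      (rpow_le_three_rpow_abs_mul _ hx' hδ (by linarith) (by linarith))
    · rw [ha, ENNReal.rpow_neg, ← ENNReal.mul_inv (.inl ha0) (.inl hat),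
        ← volume_ball_mul hd x (by norm_num) hδ]
      exact ENNReal.inv_le_inv.2 (measure_mono (ball_subset_ball (by linarith)))
    · rw [← lintegral_indicator measurableSet_ball, ← lintegral_indicator measurableSet_ball]
      refine lintegral_mono fun z => ?_
      refine indicator_apply_le' (fun _ => ?_) fun _ => zero_le
      by_cases hz : z ∈ ball x₀ (δ / 2)
      · rw [indicator_of_mem hz]
      · have : Φ z = 0 := by
          by_contra h
          exact hz (hΦ h)
        simp [this]

lemma exists_small_ball_setLIntegral_ge (d : ℕ) :
    ∃ N : ℕ, 0 < N ∧ ∀ (x₀ : EuclideanSpace ℝ (Fin d)) (δ : ℝ), 0 < δ →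
      ∀ f : EuclideanSpace ℝ (Fin d) → ℝ≥0∞, ∃ z, dist z x₀ ≤ δ / 2 ∧
        (N : ℝ≥0∞)⁻¹ * ∫⁻ y in ball x₀ (δ / 2), f y ≤ ∫⁻ y in ball z (δ / 16), f y := by
  obtain ⟨t, hts, htf, htc⟩ := (isCompact_closedBall (0 : EuclideanSpace ℝ (Fin d))
    (1 / 2)).finite_cover_balls (e := 1 / 16) (by norm_num)
  lift t to Finset (EuclideanSpace ℝ (Fin d)) using htf
  have hne : t.Nonempty := by
    obtain ⟨p, hp, -⟩ := mem_iUnion₂.1 (htc (mem_closedBall_self (by norm_num)))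
    exact ⟨p, hp⟩
  refine ⟨t.card, hne.card_pos, fun x₀ δ hδ f => ?_⟩
  obtain ⟨p, hp, hmax⟩ := t.exists_max_image
    (fun p => ∫⁻ y in ball (x₀ + δ • p) (δ / 16), f y) hne
  refine ⟨x₀ + δ • p, ?_, ?_⟩
  · have := hts hp
    rw [mem_closedBall_zero_iff] at this
    rw [dist_eq_norm, add_sub_cancel_left, norm_smul, Real.norm_of_nonneg hδ.le]
    nlinarith
  · have hcover : ball x₀ (δ / 2) ⊆ ⋃ p ∈ t, ball (x₀ + δ • p) (δ / 16) := by
      intro y hy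
      have hy' : δ⁻¹ • (y - x₀) ∈ closedBall (0 : EuclideanSpace ℝ (Fin d)) (1 / 2) := by
        rw [mem_ball, dist_eq_norm] at hy
        rw [mem_closedBall_zero_iff, norm_smul, Real.norm_of_nonneg (by positivity),
          inv_mul_le_iff₀ hδ]
        linarith
      obtain ⟨r, hr, hyr⟩ := mem_iUnion₂.1 (htc hy')
      refine mem_iUnion₂.2 ⟨r, hr, ?_⟩
      rw [mem_ball, dist_eq_norm] at hyr ⊢
      have : y - (x₀ + δ • r) = δ • (δ⁻¹ • (y - x₀) - r) := by
        rw [smul_sub, smul_inv_smul₀ hδ.ne']; abel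
      rw [this, norm_smul, Real.norm_of_nonneg hδ.le]
      nlinarith
    rw [ENNReal.inv_mul_le_iff (by simpa using hne.ne_empty) (ENNReal.natCast_ne_top _)]
    calc ∫⁻ y in ball x₀ (δ / 2), f y
        ≤ ∫⁻ y in ⋃ p ∈ t, ball (x₀ + δ • p) (δ / 16), f y := lintegral_mono_set hcover
      _ ≤ ∑ p ∈ t, ∫⁻ y in ball (x₀ + δ • p) (δ / 16), f y := by
          rw [← Finset.sum_coe_sort, ← tsum_fintype (L := .unconditional _),
            show ⋃ p ∈ t, ball (x₀ + δ • p) (δ / 16) =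
              ⋃ p : t, ball (x₀ + δ • (p : EuclideanSpace ℝ (Fin d))) (δ / 16) from
              biUnion_eq_iUnion (t : Set (EuclideanSpace ℝ (Fin d))) _]
          exact lintegral_iUnion_le _ _
      _ ≤ t.card • ∫⁻ y in ball (x₀ + δ • p) (δ / 16), f y :=
          t.sum_le_card_nsmul _ _ hmax
      _ = _ := by rw [nsmul_eq_mul]

lemma const_mul_le_avNorm {d : ℕ} (hd : 1 ≤ d) {q : ℝ} (σ : ℝ) (hq : 0 < q) :
    ∃ c : ℝ≥0∞, c ≠ 0 ∧ c ≠ ⊤ ∧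
      ∀ Ω : Set (EuclideanSpace ℝ (Fin d)), IsOpen Ω → Ωᶜ.Nonempty →
      ∀ x₀ ∈ Ω, ∀ Φ : EuclideanSpace ℝ (Fin d) → ℝ,
          c * ENNReal.ofReal (wdist Ω x₀) ^ (1 - (d : ℝ) / 2 + (d - 1 : ℝ) / q - σ) *
              (∫⁻ y in ball x₀ (wdist Ω x₀ / 2), (‖Φ y‖₊ : ℝ≥0∞) ^ (2 : ℕ)) ^ (1 / (2 : ℝ)) ≤
            avNorm q σ Ω Φ := by
  obtain ⟨N, hN, hball⟩ := exists_small_ball_setLIntegral_ge d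
  set v := volume (ball (0 : EuclideanSpace ℝ (Fin d)) 1) with hv
  have hv0 : v ≠ 0 := (measure_ball_pos _ _ one_pos).ne'
  have hvt : v ≠ ⊤ := measure_ball_lt_top.ne
  have hN0 : (N : ℝ≥0∞)⁻¹ ≠ 0 := ENNReal.inv_ne_zero.2 (ENNReal.natCast_ne_top _)
  have hNt : (N : ℝ≥0∞)⁻¹ ≠ ⊤ := ENNReal.inv_ne_top.2 (by exact_mod_cast hN.ne')
  set b := ENNReal.ofReal (3 ^ |q - 1 - q * σ|) with hb
  have hb0 : b ≠ 0 := (ENNReal.ofReal_pos.2 (by positivity)).ne'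
  have hbt : b ≠ ⊤ := ENNReal.ofReal_ne_top
  set c := ENNReal.ofReal ((1 / 16) ^ d) * v with hc
  have hc0 : c ≠ 0 := mul_ne_zero (ENNReal.ofReal_pos.2 (by positivity)).ne' hv0
  have hct : c ≠ ⊤ := ENNReal.mul_ne_top ENNReal.ofReal_ne_top hvt
  set a : ℝ≥0∞ := v⁻¹ * (N : ℝ≥0∞)⁻¹ with ha
  have ha0 : a ≠ 0 := mul_ne_zero (ENNReal.inv_ne_zero.2 hvt) hN0
  have hat : a ≠ ⊤ := ENNReal.mul_ne_top (ENNReal.inv_ne_top.2 hv0) hNt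
  have haq0 : a ^ (q / 2) ≠ 0 := (ENNReal.rpow_pos (pos_iff_ne_zero.2 ha0) hat).ne'
  have haqt : a ^ (q / 2) ≠ ⊤ := ENNReal.rpow_ne_top_of_nonneg (by positivity) hat
  have hK0 : a ^ (q / 2) * b⁻¹ * c ≠ 0 :=
    mul_ne_zero (mul_ne_zero haq0 (ENNReal.inv_ne_zero.2 hbt)) hc0
  have hKt : a ^ (q / 2) * b⁻¹ * c ≠ ⊤ :=
    ENNReal.mul_ne_top (ENNReal.mul_ne_top haqt (ENNReal.inv_ne_top.2 hb0)) hct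
  refine ⟨(a ^ (q / 2) * b⁻¹ * c) ^ (1 / q), (ENNReal.rpow_pos (pos_iff_ne_zero.2 hK0) hKt).ne',
    ENNReal.rpow_ne_top_of_nonneg (by positivity) hKt, ?_⟩
  intro Ω hΩ hne x₀ hx₀ Φ
  have hδ := wdist_pos hΩ hne hx₀
  set δ := wdist Ω x₀
  have hD0 : ENNReal.ofReal δ ≠ 0 := (ENNReal.ofReal_pos.2 hδ).ne'
  obtain ⟨z, hz, hzI⟩ := hball x₀ δ hδ fun y => (‖Φ y‖₊ : ℝ≥0∞) ^ (2 : ℕ)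
  rw [← rpow_scaling_identity hq σ d hD0 ENNReal.ofReal_ne_top, avNorm,
    ← volume_ball_mul hd z (by norm_num) hδ]
  refine ENNReal.rpow_le_rpow ?_ (by positivity)
  rw [← lintegral_indicator_const measurableSet_ball, ← lintegral_indicator hΩ.measurableSet]
  refine lintegral_mono fun x => ?_
  refine indicator_apply_le' (fun hx => ?_) fun _ => zero_le
  rw [mem_ball] at hx
  have h1 := wdist_le_wdist_add_dist Ω x x₀
  have h2 := wdist_le_wdist_add_dist Ω x₀ x
  have h3 := dist_triangle x z x₀
  rw [dist_comm x₀ x] at h2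
  change wdist Ω x ≤ δ + _ at h1
  change δ ≤ _ at h2
  have hx' : 0 < wdist Ω x := by linarith
  rw [indicator_of_mem (mem_of_wdist_pos hx')]
  refine mul_le_mul' (ENNReal.rpow_le_rpow ?_ (by positivity)) ?_
  · have hvol : volume (ball x (wdist Ω x / 2)) ≤ v * ENNReal.ofReal δ ^ (d : ℝ) := by
      have := volume_ball_mul hd x zero_le_one hδ
      rw [one_pow, ENNReal.ofReal_one, one_mul, one_mul] at this
      rw [hv, ← this]
      exact measure_mono (ball_subset_ball (by linarith))
    have hI : (N : ℝ≥0∞)⁻¹ * ∫⁻ y in ball x₀ (δ / 2), (‖Φ y‖₊ : ℝ≥0∞) ^ (2 : ℕ) ≤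
        ∫⁻ y in ball x (wdist Ω x / 2), (‖Φ y‖₊ : ℝ≥0∞) ^ (2 : ℕ) :=
      hzI.trans (lintegral_mono_set (ball_subset_ball' (by rw [dist_comm z x]; linarith)))
    refine le_trans (le_of_eq ?_) (mul_le_mul' (ENNReal.inv_le_inv.2 hvol) hI)
    rw [ha, ENNReal.mul_inv (.inl hv0) (.inl hvt), ENNReal.rpow_neg]
    ring
  · rw [ENNReal.inv_mul_le_iff hb0 hbt]
    exact rpow_le_three_rpow_abs_mul _ hδ hx' (by linarith) (by linarith)

theorem whitney_supported_avNorm_comparable (d : ℕ) (hd : 1 ≤ d) (q σ : ℝ) (hq0 : 0 < q) :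
    ∃ C : ℝ, 1 < C ∧
      ∀ Ω : Set (EuclideanSpace ℝ (Fin d)), IsOpen Ω → Ωᶜ.Nonempty →
      ∀ x₀ ∈ Ω, ∀ Φ : EuclideanSpace ℝ (Fin d) → ℝ, Measurable Φ →
        (∫⁻ y, (‖Φ y‖₊ : ℝ≥0∞) ^ (2 : ℕ)) < ⊤ →
        Function.support Φ ⊆ Metric.ball x₀ (wdist Ω x₀ / 2) →
          ENNReal.ofReal C⁻¹ *
              ENNReal.ofReal
                (wdist Ω x₀ ^ (1 - (d : ℝ) / 2 + (d - 1 : ℝ) / q - σ)) *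
              (∫⁻ y in Metric.ball x₀ (wdist Ω x₀ / 2),
                (‖Φ y‖₊ : ℝ≥0∞) ^ (2 : ℕ)) ^ (1 / (2 : ℝ)) ≤
            avNorm q σ Ω Φ ∧
          avNorm q σ Ω Φ ≤
            ENNReal.ofReal C *
              ENNReal.ofReal
                (wdist Ω x₀ ^ (1 - (d : ℝ) / 2 + (d - 1 : ℝ) / q - σ)) *
              (∫⁻ y in Metric.ball x₀ (wdist Ω x₀ / 2),
                (‖Φ y‖₊ : ℝ≥0∞) ^ (2 : ℕ)) ^ (1 / (2 : ℝ)) := by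
  obtain ⟨C₁, hC₁, hupper⟩ := avNorm_le_of_support_subset hd σ hq0
  obtain ⟨c, hc0, hct, hlower⟩ := const_mul_le_avNorm hd σ hq0
  have hcpos : 0 < c.toReal := ENNReal.toReal_pos hc0 hct
  refine ⟨max 2 (max C₁.toReal c.toReal⁻¹), lt_max_of_lt_left one_lt_two, ?_⟩
  intro Ω hΩ hne x₀ hx₀ Φ _ _ hΦ
  rw [← ENNReal.ofReal_rpow_of_pos (wdist_pos hΩ hne hx₀)]
  refine ⟨le_trans ?_ (hlower Ω hΩ hne x₀ hx₀ Φ),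
    (hupper Ω hΩ hne x₀ hx₀ Φ hΦ).trans ?_⟩
  · gcongr
    exact (ENNReal.ofReal_le_iff_le_toReal hct).2
      (inv_le_of_inv_le₀ hcpos ((le_max_right _ _).trans (le_max_right _ _)))
  · gcongr
    exact (ENNReal.le_ofReal_iff_toReal_le hC₁ (by positivity)).2
      ((le_max_left _ _).trans (le_max_right _ _))
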